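/- Let a, b, c, d be complex numbers with ab = cd. Then S(H(a,b)) = S(H(c,d)); that is, the set of complex numbers λ which are an eigenvalue of H_t(a,b) for some t ∈ (−π, π] coincides with the set of λ which are an eigenvalue of H_t(c,d) for some t ∈ (−π, π]. -/

import Mathlib

open Real Complex Set

/-- The Mathieu potential `a·exp(−2πi x) + b·exp(2πi x)`. -/
noncomputable def mathieuPot (a b : ℂ) (x : ℝ) : ℂ :=
  a * Complex.exp (-(2 * Real.pi * Complex.I) * (x : ℂ)) +
    b * Complex.exp (2 * Real.pi * Complex.I * (x : ℂ))

/-- `λ` is an eigenvalue of the operator `H_t(a,b)`: there is a twice continuously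
differentiable function `y`, not identically zero on `[0,1]`, satisfying
`−y'' + (a e^{−2πix} + b e^{2πix}) y = λ y` on `[0,1]` with the `t`-quasiperiodic
boundary conditions. -/
def IsEigenvalueH (a b : ℂ) (t : ℝ) (lam : ℂ) : Prop :=
  ∃ y : ℝ → ℂ, ContDiff ℝ 2 y ∧
    (¬ ∀ x ∈ Set.Icc (0:ℝ) 1, y x = 0) ∧
    (∀ x ∈ Set.Icc (0:ℝ) 1,
      -(deriv (deriv y) x) + mathieuPot a b x * y x = lam * y x) ∧
    y 1 = Complex.exp (Complex.I * t) * y 0 ∧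
    deriv y 1 = Complex.exp (Complex.I * t) * deriv y 0

/-- The frequency `t + 2πn` of the `n`-th Floquet mode. -/
noncomputable def floquetFreq (t : ℝ) (n : ℤ) : ℝ := t + 2 * Real.pi * n

lemma floquetFreq_neg (t : ℝ) (n : ℤ) : floquetFreq (-t) (-n) = -floquetFreq t n := by
  simp only [floquetFreq]
  push_cast
  ring

/-- `u` solves the three-term recurrence satisfied by the Fourier coefficients of a
`t`-quasiperiodic solution of the Mathieu equation. -/
def IsMathieuRec (a b : ℂ) (t : ℝ) (lam : ℂ) (u : ℤ → ℂ) : Prop :=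
  ∀ n, a * u (n + 1) + b * u (n - 1) = (lam - (floquetFreq t n : ℂ) ^ 2) * u n

/-- The recurrence has a nonzero bounded solution. -/
def HasBoundedSol (a b : ℂ) (t : ℝ) (lam : ℂ) : Prop :=
  ∃ u : ℤ → ℂ, u ≠ 0 ∧ (∃ B : ℝ, ∀ n, ‖u n‖ ≤ B) ∧ IsMathieuRec a b t lam u

lemma exists_le_norm_sub_floquetFreq_sq (t : ℝ) (lam : ℂ) (K : ℝ) :
    ∃ N : ℕ, ∀ n : ℤ, N ≤ n.natAbs → K ≤ ‖lam - (floquetFreq t n : ℂ) ^ 2‖ := by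
  obtain ⟨N, hN⟩ := exists_nat_ge (|t| + 1 + |K| + ‖lam‖)
  refine ⟨N, fun n hn => ?_⟩
  have hn' : (N : ℝ) ≤ |(n : ℝ)| := by
    rw [← Int.cast_abs, Int.abs_eq_natAbs]
    exact_mod_cast hn
  have hfreq : 1 + |K| + ‖lam‖ ≤ |floquetFreq t n| := by
    have h1 : |2 * Real.pi * n| ≤ |floquetFreq t n| + |t| := by
      have := abs_sub (floquetFreq t n) t
      rwa [floquetFreq, add_sub_cancel_left] at this
    rw [abs_mul, abs_of_pos (by positivity : 0 < 2 * Real.pi)] at h1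
    nlinarith [Real.pi_gt_three, abs_nonneg (n : ℝ)]
  have hsq : 1 + |K| + ‖lam‖ ≤ floquetFreq t n ^ 2 := by
    rw [← sq_abs]
    nlinarith [abs_nonneg K, norm_nonneg lam]
  have hnorm : ‖(floquetFreq t n : ℂ) ^ 2‖ = floquetFreq t n ^ 2 := by
    rw [norm_pow, Complex.norm_real, Real.norm_eq_abs, sq_abs]
  have := norm_sub_norm_le ((floquetFreq t n : ℂ) ^ 2) lam
  rw [norm_sub_rev, hnorm] at this
  linarith [le_abs_self K]

/-- Bounded solutions of the recurrence decay faster than any geometric sequence. -/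
lemma IsMathieuRec.exists_decay {a b : ℂ} {t : ℝ} {lam : ℂ} {u : ℤ → ℂ}
    (hu : IsMathieuRec a b t lam u) {B : ℝ} (hB : ∀ n, ‖u n‖ ≤ B) {R : ℝ} (hR : 1 ≤ R) :
    ∃ C : ℝ, ∀ n, ‖u n‖ * R ^ n.natAbs ≤ C := by
  have hR0 : 0 < R := by linarith
  have hB0 : 0 ≤ B := (norm_nonneg _).trans (hB 0)
  obtain ⟨N, hN⟩ := exists_le_norm_sub_floquetFreq_sq t lam ((‖a‖ + ‖b‖ + 1) * R)
  have key : ∀ (k : ℕ) (n : ℤ), N + k ≤ n.natAbs → ‖u n‖ * R ^ k ≤ B := by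
    intro k
    induction k with
    | zero => intro n _; simpa using hB n
    | succ k ih =>
      intro n hn
      have h1 := ih (n + 1) (by omega)
      have h2 := ih (n - 1) (by omega)
      have h3 : (‖a‖ + ‖b‖ + 1) * R * ‖u n‖ ≤ ‖a‖ * ‖u (n + 1)‖ + ‖b‖ * ‖u (n - 1)‖ :=
        calc (‖a‖ + ‖b‖ + 1) * R * ‖u n‖
            ≤ ‖lam - (floquetFreq t n : ℂ) ^ 2‖ * ‖u n‖ := by
              gcongr; exact hN n (by omega)
          _ = ‖a * u (n + 1) + b * u (n - 1)‖ := by rw [hu n, norm_mul]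
          _ ≤ _ := by
              simpa only [norm_mul] using norm_add_le (a * u (n + 1)) (b * u (n - 1))
      have h4 : (‖a‖ + ‖b‖ + 1) * (‖u n‖ * R ^ (k + 1)) ≤ (‖a‖ + ‖b‖ + 1) * B :=
        calc (‖a‖ + ‖b‖ + 1) * (‖u n‖ * R ^ (k + 1))
            = (‖a‖ + ‖b‖ + 1) * R * ‖u n‖ * R ^ k := by ring
          _ ≤ (‖a‖ * ‖u (n + 1)‖ + ‖b‖ * ‖u (n - 1)‖) * R ^ k := by gcongr
          _ = ‖a‖ * (‖u (n + 1)‖ * R ^ k) + ‖b‖ * (‖u (n - 1)‖ * R ^ k) := by ring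
          _ ≤ ‖a‖ * B + ‖b‖ * B := by gcongr
          _ ≤ _ := by linarith
      exact le_of_mul_le_mul_left h4 (by positivity)
  refine ⟨B * R ^ N, fun n => ?_⟩
  rcases le_total N n.natAbs with hn | hn
  · obtain ⟨k, hk⟩ := Nat.exists_eq_add_of_le hn
    rw [hk, pow_add, mul_comm (R ^ N), ← mul_assoc]
    gcongr
    exact key k n hk.ge
  · gcongr
    exact hB n

lemma HasBoundedSol.of_mul_eq_mul {a b c d : ℂ} {t : ℝ} {lam : ℂ} (h : a * b = c * d)
    (hab : a * b ≠ 0) (H : HasBoundedSol a b t lam) : HasBoundedSol c d t lam := by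
  obtain ⟨u, hu0, ⟨B, hB⟩, hu⟩ := H
  have ha : a ≠ 0 := left_ne_zero_of_mul hab
  have hc : c ≠ 0 := left_ne_zero_of_mul (h ▸ hab)
  set r : ℂ := a / c with hr
  have hr0 : r ≠ 0 := div_ne_zero ha hc
  have hcr : c * r = a := by rw [hr]; field_simp
  have hd : d = b * r := by rw [hr]; field_simp; linear_combination -h
  obtain ⟨C, hC⟩ := hu.exists_decay hB (le_max_left 1 (max ‖r‖ ‖r⁻¹‖))
  refine ⟨fun n => r ^ n * u n, fun h0 => hu0 ?_, ⟨C, fun n => ?_⟩, fun n => ?_⟩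
  · funext n
    simpa [hr0, zpow_ne_zero] using congrFun h0 n
  · refine le_trans ?_ (hC n)
    rw [norm_mul, mul_comm]
    gcongr
    rcases Int.natAbs_eq n with hn | hn
    · rw [hn, zpow_natCast, norm_pow, Int.natAbs_natCast]
      gcongr
      simp
    · rw [hn, zpow_neg, zpow_natCast, ← inv_pow, norm_pow, Int.natAbs_neg, Int.natAbs_natCast]
      gcongr
      simp
  · have h1 : r ^ (n + 1) = r ^ n * r := zpow_add_one₀ hr0 n
    have h2 : r ^ n = r ^ (n - 1) * r := by rw [← zpow_add_one₀ hr0, sub_add_cancel]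
    linear_combination r ^ n * hu n + c * u (n + 1) * h1 + r ^ n * u (n + 1) * hcr
      + r ^ (n - 1) * u (n - 1) * hd - b * u (n - 1) * h2

lemma HasBoundedSol.reflect {a b : ℂ} {t : ℝ} {lam : ℂ} (H : HasBoundedSol a b t lam) :
    HasBoundedSol b a (-t) lam := by
  obtain ⟨u, hu0, ⟨B, hB⟩, hu⟩ := H
  refine ⟨fun n => u (-n), fun h0 => hu0 ?_, ⟨B, fun n => hB _⟩, fun n => ?_⟩
  · funext n
    simpa using congrFun h0 (-n)
  · have := hu (-n)
    rw [show -n + 1 = -(n - 1) by ring, show -n - 1 = -(n + 1) by ring] at this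
    simp only [floquetFreq] at this ⊢
    push_cast at this ⊢
    linear_combination this

lemma HasBoundedSol.exists_eq_sq {b : ℂ} {t : ℝ} {lam : ℂ} (H : HasBoundedSol 0 b t lam) :
    ∃ n : ℤ, lam = (floquetFreq t n : ℂ) ^ 2 := by
  by_contra! hne
  obtain ⟨u, hu0, ⟨B, hB⟩, hu⟩ := H
  have hrec : ∀ n, b * u (n - 1) = (lam - (floquetFreq t n : ℂ) ^ 2) * u n := fun n => by
    simpa using hu n
  obtain ⟨N, hN⟩ := exists_le_norm_sub_floquetFreq_sq t lam ((‖b‖ + 1) * 2)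
  have step : ∀ n : ℤ, n ≤ -N → 2 * ‖u n‖ ≤ ‖u (n - 1)‖ := by
    intro n hn
    have h1 : (‖b‖ + 1) * (2 * ‖u n‖) ≤ (‖b‖ + 1) * ‖u (n - 1)‖ :=
      calc (‖b‖ + 1) * (2 * ‖u n‖) = (‖b‖ + 1) * 2 * ‖u n‖ := by ring
        _ ≤ ‖lam - (floquetFreq t n : ℂ) ^ 2‖ * ‖u n‖ := by gcongr; exact hN n (by omega)
        _ = ‖b‖ * ‖u (n - 1)‖ := by rw [← norm_mul, ← hrec n, norm_mul]
        _ ≤ _ := by gcongr; linarith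
    exact le_of_mul_le_mul_left h1 (by positivity)
  have growth : ∀ (k : ℕ) (n : ℤ), n ≤ -N → 2 ^ k * ‖u n‖ ≤ B := by
    intro k
    induction k with
    | zero => intro n _; simpa using hB n
    | succ k ih =>
      intro n hn
      calc 2 ^ (k + 1) * ‖u n‖ = 2 ^ k * (2 * ‖u n‖) := by ring
        _ ≤ 2 ^ k * ‖u (n - 1)‖ := by gcongr; exact step n hn
        _ ≤ B := ih _ (by omega)
  have hlow : ∀ n : ℤ, n ≤ -N → u n = 0 := by
    intro n hn
    by_contra hne'
    have hpos : 0 < ‖u n‖ := norm_pos_iff.mpr hne'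
    obtain ⟨k, hk⟩ := pow_unbounded_of_one_lt (B / ‖u n‖) (one_lt_two (α := ℝ))
    rw [div_lt_iff₀ hpos] at hk
    linarith [growth k n hn]
  have hup : ∀ k : ℕ, u (-N + k) = 0 := by
    intro k
    induction k with
    | zero => exact hlow _ (by simp)
    | succ k ih =>
      have h1 := hrec (-N + (k + 1 : ℕ))
      rw [show -(N : ℤ) + (k + 1 : ℕ) - 1 = -N + k by push_cast; ring, ih, mul_zero] at h1
      exact (mul_eq_zero.mp h1.symm).resolve_left (sub_ne_zero.mpr (hne _))
  refine hu0 (funext fun n => ?_)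
  rcases le_total n (-N) with hn | hn
  · exact hlow n hn
  · obtain ⟨k, rfl⟩ := Int.le.dest hn
    exact hup k

lemma exists_bound_of_norm_le_succ {f : ℕ → ℂ} {N : ℕ} (h : ∀ n ≥ N, ‖f (n + 1)‖ ≤ ‖f n‖) :
    ∃ B : ℝ, ∀ n, ‖f n‖ ≤ B := by
  have htail : ∀ n ≥ N, ‖f n‖ ≤ ‖f N‖ := fun n hn => by
    induction n, hn using Nat.le_induction with
    | base => rfl
    | succ n hn ih => exact (h n hn).trans ih
  refine ⟨∑ i ∈ Finset.range (N + 1), ‖f i‖, fun n => ?_⟩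
  rcases le_total n N with hn | hn
  · exact Finset.single_le_sum (f := fun i => ‖f i‖) (fun _ _ => norm_nonneg _)
      (Finset.mem_range.mpr (by omega))
  · exact (htail n hn).trans <| Finset.single_le_sum (f := fun i => ‖f i‖)
      (fun _ _ => norm_nonneg _) (Finset.mem_range.mpr (by omega))

lemma HasBoundedSol.of_exists_eq_sq (b : ℂ) {t : ℝ} {lam : ℂ}
    (H : ∃ n : ℤ, lam = (floquetFreq t n : ℂ) ^ 2) : HasBoundedSol 0 b t lam := by
  have hbdd : ∃ M : ℤ, ∀ n : ℤ, lam = (floquetFreq t n : ℂ) ^ 2 → n ≤ M := by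
    obtain ⟨N, hN⟩ := exists_le_norm_sub_floquetFreq_sq t lam 1
    refine ⟨N, fun n hn => ?_⟩
    by_contra! hlt
    have := hN n (by omega)
    rw [hn, sub_self, norm_zero] at this
    linarith
  obtain ⟨m, hm, hmax⟩ := Int.exists_greatest_of_bdd hbdd H
  have hq : ∀ n, m < n → lam - (floquetFreq t n : ℂ) ^ 2 ≠ 0 := fun n hn h0 =>
    absurd (hmax n (sub_eq_zero.mp h0)) (not_le.mpr hn)
  let f : ℕ → ℂ := fun k =>
    ∏ j ∈ Finset.range k, b / (lam - (floquetFreq t (m + (j + 1 : ℕ)) : ℂ) ^ 2)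
  have hf : ∀ k, f (k + 1) = f k * (b / (lam - (floquetFreq t (m + (k + 1 : ℕ)) : ℂ) ^ 2)) :=
    fun k => Finset.prod_range_succ _ _
  obtain ⟨B, hB⟩ : ∃ B : ℝ, ∀ k, ‖f k‖ ≤ B := by
    obtain ⟨N, hN⟩ := exists_le_norm_sub_floquetFreq_sq t lam ‖b‖
    refine exists_bound_of_norm_le_succ (N := N + m.natAbs) fun k hk => ?_
    rw [hf, norm_mul, norm_div]
    exact mul_le_of_le_one_right (norm_nonneg _)
      (div_le_one_of_le₀ (hN _ (by omega)) (norm_nonneg _))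
  have hB0 : 0 ≤ B := (norm_nonneg _).trans (hB 0)
  refine ⟨fun n => if n < m then 0 else f (n - m).toNat, fun h0 => ?_, ⟨B, fun n => ?_⟩,
    fun n => ?_⟩
  · simpa [f] using congrFun h0 m
  · dsimp only
    split_ifs
    · simpa using hB0
    · exact hB _
  · rw [zero_mul, zero_add]
    rcases lt_trichotomy n m with hn | rfl | hn
    · simp [hn, show n - 1 < m by omega]
    · simp [← hm]
    · obtain ⟨k, rfl⟩ : ∃ k : ℕ, n = m + (k + 1 : ℕ) := ⟨(n - m - 1).toNat, by omega⟩
      dsimp only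
      rw [if_neg (by omega), if_neg (by omega),
        show (m + ((k + 1 : ℕ) : ℤ) - 1 - m).toNat = k by omega,
        show (m + ((k + 1 : ℕ) : ℤ) - m).toNat = k + 1 by omega, hf]
      have := hq (m + (k + 1 : ℕ)) (by omega)
      field_simp

lemma hasBoundedSol_iff_exists_eq_sq {a b : ℂ} {t : ℝ} {lam : ℂ} (hab : a * b = 0) :
    HasBoundedSol a b t lam ↔ ∃ n : ℤ, lam = (floquetFreq t n : ℂ) ^ 2 := by
  rcases mul_eq_zero.mp hab with rfl | rfl
  · exact ⟨HasBoundedSol.exists_eq_sq, HasBoundedSol.of_exists_eq_sq b⟩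
  · have hneg : ∀ (s : ℝ) (n : ℤ),
        (floquetFreq (-s) (-n) : ℂ) ^ 2 = (floquetFreq s n : ℂ) ^ 2 := fun s n => by
      rw [floquetFreq_neg, Complex.ofReal_neg, neg_sq]
    constructor
    · intro H
      obtain ⟨n, hn⟩ := H.reflect.exists_eq_sq
      exact ⟨-n, by rw [hn, ← hneg, neg_neg]⟩
    · rintro ⟨n, hn⟩
      have := (HasBoundedSol.of_exists_eq_sq a (t := -t) ⟨-n, hn.trans (hneg t n).symm⟩).reflect
      rwa [neg_neg] at this

lemma hasBoundedSol_congr {a b c d : ℂ} (h : a * b = c * d) (t : ℝ) (lam : ℂ) :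
    HasBoundedSol a b t lam ↔ HasBoundedSol c d t lam := by
  by_cases hab : a * b = 0
  · rw [hasBoundedSol_iff_exists_eq_sq hab, hasBoundedSol_iff_exists_eq_sq (h ▸ hab)]
  · exact ⟨.of_mul_eq_mul h hab, .of_mul_eq_mul h.symm (h ▸ hab)⟩

/-- The Floquet mode `x ↦ exp(i (t + 2πn) x)`. -/
noncomputable def floquetMode (t : ℝ) (n : ℤ) (x : ℝ) : ℂ :=
  Complex.exp (Complex.I * floquetFreq t n * x)

lemma norm_floquetMode (t : ℝ) (n : ℤ) (x : ℝ) : ‖floquetMode t n x‖ = 1 := by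
  rw [floquetMode, mul_assoc, mul_comm, ← Complex.ofReal_mul, Complex.norm_exp_ofReal_mul_I]

lemma hasDerivAt_floquetMode (t : ℝ) (n : ℤ) (x : ℝ) :
    HasDerivAt (floquetMode t n) (Complex.I * floquetFreq t n * floquetMode t n x) x := by
  have h := ((hasDerivAt_id (x : ℂ)).const_mul (Complex.I * floquetFreq t n)).cexp.comp_ofReal
  change HasDerivAt (fun x : ℝ => Complex.exp (Complex.I * floquetFreq t n * x))
    (Complex.I * floquetFreq t n * Complex.exp (Complex.I * floquetFreq t n * x)) x
  simpa [mul_comm] using h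

lemma continuous_floquetMode (t : ℝ) (n : ℤ) : Continuous (floquetMode t n) := by
  unfold floquetMode
  fun_prop

lemma floquetMode_zero (t : ℝ) (n : ℤ) : floquetMode t n 0 = 1 := by
  simp [floquetMode]

lemma floquetMode_one (t : ℝ) (n : ℤ) : floquetMode t n 1 = Complex.exp (Complex.I * t) := by
  rw [floquetMode, floquetFreq, Complex.exp_eq_exp_iff_exists_int]
  exact ⟨n, by push_cast; ring⟩

lemma mathieuPot_mul_floquetMode (a b : ℂ) (t : ℝ) (n : ℤ) (x : ℝ) :
    mathieuPot a b x * floquetMode t n x =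
      a * floquetMode t (n - 1) x + b * floquetMode t (n + 1) x := by
  simp only [mathieuPot, floquetMode, add_mul, mul_assoc, ← Complex.exp_add, floquetFreq]
  push_cast
  ring_nf

lemma floquetMode_mul_floquetMode_neg (t : ℝ) (n m : ℤ) (x : ℝ) :
    floquetMode t n x * floquetMode (-t) (-m) x = floquetMode 0 (n - m) x := by
  simp only [floquetMode, ← Complex.exp_add, floquetFreq]
  push_cast
  ring_nf

lemma integral_floquetMode_zero (n : ℤ) :
    ∫ x in (0:ℝ)..1, floquetMode 0 n x = if n = 0 then 1 else 0 := by
  split_ifs with hn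
  · simp [hn, floquetMode, floquetFreq]
  · have hc : Complex.I * (floquetFreq 0 n : ℂ) ≠ 0 := by
      simp [floquetFreq, hn, Real.pi_ne_zero]
    have h1 := floquetMode_one 0 n
    have h0 := floquetMode_zero 0 n
    simp only [floquetMode] at h0 h1 ⊢
    rw [integral_exp_mul_complex hc, h1, h0]
    simp

/-- The Floquet series with coefficients `v`. -/
noncomputable def floquetSeries (t : ℝ) (v : ℤ → ℂ) (x : ℝ) : ℂ :=
  ∑' n, v n * floquetMode t n x

lemma summable_mul_floquetMode (t : ℝ) {v : ℤ → ℂ} (hv : Summable fun n => ‖v n‖) (x : ℝ) :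
    Summable fun n => v n * floquetMode t n x :=
  Summable.of_norm (by simpa [norm_floquetMode] using hv)

lemma continuous_floquetSeries (t : ℝ) {v : ℤ → ℂ} (hv : Summable fun n => ‖v n‖) :
    Continuous (floquetSeries t v) :=
  continuous_tsum (fun n => (continuous_floquetMode t n).const_mul (v n)) hv
    fun n x => by simp [norm_floquetMode]

lemma hasDerivAt_floquetSeries (t : ℝ) {v : ℤ → ℂ} (hv : Summable fun n => ‖v n‖)
    (hv' : Summable fun n => ‖Complex.I * floquetFreq t n * v n‖) (x : ℝ) :
    HasDerivAt (floquetSeries t v)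
      (floquetSeries t (fun n => Complex.I * floquetFreq t n * v n) x) x := by
  refine hasDerivAt_tsum (g := fun n x => v n * floquetMode t n x)
    (g' := fun n x => Complex.I * floquetFreq t n * v n * floquetMode t n x) (y₀ := 0) hv'
    (fun n y => ?_) (fun n y => ?_) (summable_mul_floquetMode t hv 0) x
  · exact ((hasDerivAt_floquetMode t n y).const_mul (v n)).congr_deriv (by ring)
  · simp [norm_floquetMode]

lemma floquetSeries_one (t : ℝ) (v : ℤ → ℂ) :
    floquetSeries t v 1 = Complex.exp (Complex.I * t) * floquetSeries t v 0 := by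
  simp only [floquetSeries, floquetMode_one, floquetMode_zero, mul_one, tsum_mul_right]
  ring

lemma integral_floquetSeries_mul (t : ℝ) {v : ℤ → ℂ} (hv : Summable fun n => ‖v n‖) (m : ℤ) :
    ∫ x in (0:ℝ)..1, floquetSeries t v x * floquetMode (-t) (-m) x = v m := by
  have hbound : ∀ n : ℤ, ∀ x : ℝ, ‖v n * floquetMode 0 (n - m) x‖ ≤ ‖v n‖ := fun n x => by
    simp [norm_floquetMode]
  have key := intervalIntegral.hasSum_integral_of_dominated_convergence
    (μ := MeasureTheory.volume) (a := 0) (b := 1)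
    (F := fun n x => v n * floquetMode 0 (n - m) x)
    (f := fun x => floquetSeries t v x * floquetMode (-t) (-m) x) (fun n _ => ‖v n‖)
    (fun n => ((continuous_floquetMode 0 (n - m)).const_mul (v n)).aestronglyMeasurable)
    (fun n => .of_forall fun x _ => hbound n x) (.of_forall fun _ _ => hv) (by simp)
    (.of_forall fun x _ => by
      have := (summable_mul_floquetMode t hv x).hasSum.mul_right (floquetMode (-t) (-m) x)
      simp only [mul_assoc, floquetMode_mul_floquetMode_neg] at this
      exact this)
  rw [← key.tsum_eq, tsum_eq_single m]
  · simp [integral_floquetMode_zero]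
  · intro n hn
    rw [intervalIntegral.integral_const_mul, integral_floquetMode_zero,
      if_neg (sub_ne_zero.mpr hn), mul_zero]

lemma mathieuPot_mul_floquetSeries (a b : ℂ) (t : ℝ) {v : ℤ → ℂ}
    (hv : Summable fun n => ‖v n‖) (x : ℝ) :
    mathieuPot a b x * floquetSeries t v x =
      floquetSeries t (fun n => a * v (n + 1) + b * v (n - 1)) x := by
  have hsumL : Summable fun n => a * v n * floquetMode t (n - 1) x :=
    Summable.of_norm (by simpa [norm_floquetMode] using hv.mul_left ‖a‖)
  have hsumR : Summable fun n => b * v n * floquetMode t (n + 1) x :=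
    Summable.of_norm (by simpa [norm_floquetMode] using hv.mul_left ‖b‖)
  have hL : HasSum (fun n => a * v (n + 1) * floquetMode t n x)
      (∑' n, a * v n * floquetMode t (n - 1) x) := by
    have := (Equiv.addRight (1 : ℤ)).hasSum_iff.mpr hsumL.hasSum
    simpa [Function.comp_def] using this
  have hR : HasSum (fun n => b * v (n - 1) * floquetMode t n x)
      (∑' n, b * v n * floquetMode t (n + 1) x) := by
    have := (Equiv.subRight (1 : ℤ)).hasSum_iff.mpr hsumR.hasSum
    simpa [Function.comp_def] using this
  have hLR := (hL.add hR).tsum_eq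
  simp only [← add_mul] at hLR
  rw [floquetSeries, floquetSeries, hLR, ← hsumL.tsum_add hsumR, ← tsum_mul_left]
  refine tsum_congr fun n => ?_
  linear_combination v n * mathieuPot_mul_floquetMode a b t n x

lemma summable_norm_of_decay {u : ℤ → ℂ} {C : ℝ} (hC : ∀ n, ‖u n‖ * 2 ^ n.natAbs ≤ C) :
    Summable fun n => ‖u n‖ := by
  have hgeom : Summable fun n : ℤ => C * (1 / 2 : ℝ) ^ n.natAbs :=
    Summable.mul_left C <| Summable.of_nat_of_neg
      (by simpa using summable_geometric_two) (by simpa using summable_geometric_two)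
  refine Summable.of_nonneg_of_le (fun _ => norm_nonneg _) (fun n => ?_) hgeom
  rw [one_div, inv_pow, ← div_eq_mul_inv, le_div_iff₀ (by positivity)]
  exact hC n

lemma HasBoundedSol.isEigenvalueH {a b : ℂ} {t : ℝ} {lam : ℂ} (H : HasBoundedSol a b t lam) :
    IsEigenvalueH a b t lam := by
  obtain ⟨u, hu0, ⟨B, hB⟩, hu⟩ := H
  obtain ⟨C, hC⟩ := hu.exists_decay hB one_le_two
  have s0 : Summable fun n => ‖u n‖ := summable_norm_of_decay hC
  have s2 : Summable fun n =>
      ‖Complex.I * floquetFreq t n * (Complex.I * floquetFreq t n * u n)‖ := by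
    have hplus : Summable fun n => ‖u (n + 1)‖ :=
      (Equiv.addRight (1 : ℤ)).summable_iff (f := fun n => ‖u n‖) |>.mpr s0
    have hminus : Summable fun n => ‖u (n - 1)‖ :=
      (Equiv.subRight (1 : ℤ)).summable_iff (f := fun n => ‖u n‖) |>.mpr s0
    refine Summable.of_nonneg_of_le (fun _ => norm_nonneg _) (fun n => ?_)
      (((hplus.mul_left ‖a‖).add (hminus.mul_left ‖b‖)).add (s0.mul_left ‖lam‖))
    have heq : Complex.I * floquetFreq t n * (Complex.I * floquetFreq t n * u n) =
        a * u (n + 1) + b * u (n - 1) - lam * u n := by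
      linear_combination (floquetFreq t n : ℂ) ^ 2 * u n * Complex.I_sq - hu n
    rw [heq, ← norm_mul, ← norm_mul, ← norm_mul]
    exact (norm_sub_le _ _).trans (by gcongr; exact norm_add_le _ _)
  have s1 : Summable fun n => ‖Complex.I * floquetFreq t n * u n‖ := by
    refine Summable.of_nonneg_of_le (fun _ => norm_nonneg _) (fun n => ?_) (s0.add s2)
    simp only [norm_mul, Complex.norm_I, one_mul]
    nlinarith [sq_nonneg (‖(floquetFreq t n : ℂ)‖ - 1), norm_nonneg (u n),
      mul_nonneg (norm_nonneg (u n)) (sq_nonneg (‖(floquetFreq t n : ℂ)‖ - 1)),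
      mul_nonneg (norm_nonneg (u n)) (norm_nonneg (floquetFreq t n : ℂ))]
  have hd1 := hasDerivAt_floquetSeries t s0 s1
  have hd2 := hasDerivAt_floquetSeries t s1 s2
  have e1 : deriv (floquetSeries t u) = _ := funext fun x => (hd1 x).deriv
  have e2 : deriv (floquetSeries t fun n => Complex.I * floquetFreq t n * u n) = _ :=
    funext fun x => (hd2 x).deriv
  refine ⟨floquetSeries t u, ?_, fun h0 => hu0 (funext fun m => ?_), fun x _ => ?_,
    floquetSeries_one t u, ?_⟩
  · rw [show (2 : WithTop ℕ∞) = 1 + 1 by norm_num, contDiff_succ_iff_deriv, e1,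
      contDiff_one_iff_deriv, e2]
    exact ⟨fun x => (hd1 x).differentiableAt, by simp, fun x => (hd2 x).differentiableAt,
      continuous_floquetSeries t s2⟩
  · rw [← integral_floquetSeries_mul t s0 m, Pi.zero_apply]
    refine intervalIntegral.integral_zero_ae (.of_forall fun x hx => ?_)
    rw [Set.uIoc_of_le zero_le_one] at hx
    rw [h0 x ⟨hx.1.le, hx.2⟩, zero_mul]
  · rw [e1, e2, mathieuPot_mul_floquetSeries a b t s0]
    have hrec : (fun n => a * u (n + 1) + b * u (n - 1)) = fun n =>
        lam * u n + Complex.I * floquetFreq t n * (Complex.I * floquetFreq t n * u n) :=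
      funext fun n => by
        linear_combination hu n - (floquetFreq t n : ℂ) ^ 2 * u n * Complex.I_sq
    rw [hrec]
    simp only [floquetSeries, add_mul]
    rw [Summable.tsum_add, ← tsum_mul_left]
    · simp only [mul_assoc]
      ring
    · simpa only [mul_assoc] using (summable_mul_floquetMode t s0 x).mul_left lam
    · exact summable_mul_floquetMode t s2 x
  · rw [e1]
    exact floquetSeries_one t _

lemma eq_zero_on_Icc_of_integral_floquetMode_eq_zero {t : ℝ} {y : ℝ → ℂ} (hy : Continuous y)
    (hbc : y 1 = Complex.exp (Complex.I * t) * y 0)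
    (h : ∀ n, ∫ x in (0:ℝ)..1, y x * floquetMode (-t) (-n) x = 0) :
    ∀ x ∈ Set.Icc (0:ℝ) 1, y x = 0 := by
  set z : ℝ → ℂ := fun x => y x * floquetMode (-t) 0 x with hz
  have hzc : Continuous z := hy.mul (continuous_floquetMode _ _)
  have hz01 : z 0 = z 1 := by
    simp only [hz, floquetMode_one, floquetMode_zero, hbc, mul_one]
    rw [mul_right_comm, ← Complex.exp_add]
    simp
  let f : C(AddCircle (1 : ℝ), ℂ) :=
    ⟨AddCircle.liftIco 1 0 z, AddCircle.liftIco_zero_continuous hz01 hzc.continuousOn⟩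
  have hcoeff : fourierCoeff f = 0 := by
    funext n
    rw [Pi.zero_apply, ← h n, fourierCoeff_eq_intervalIntegral _ _ 0]
    simp only [zero_add, div_one, one_smul]
    refine intervalIntegral.integral_congr_Ioo_of_le zero_le_one fun x hx => ?_
    change fourier (-n) (x : AddCircle (1 : ℝ)) • AddCircle.liftIco 1 0 z x = _
    rw [AddCircle.liftIco_zero_coe_apply ⟨hx.1.le, hx.2⟩, fourier_coe_apply]
    simp only [hz, floquetMode, floquetFreq, smul_eq_mul]
    rw [mul_left_comm, ← Complex.exp_add]
    push_cast
    ring_nf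
  have hf : f = 0 := by
    have hs := hasSum_fourier_series_of_summable (f := f) (by rw [hcoeff]; exact summable_zero)
    have hzero : (fun i => fourierCoeff f i • fourier i) = fun _ => (0 : C(AddCircle (1 : ℝ), ℂ)) :=
      funext fun i => by rw [hcoeff]; exact zero_smul ℂ (fourier i : C(AddCircle (1 : ℝ), ℂ))
    rw [hzero] at hs
    exact hs.unique hasSum_zero
  have hIco : ∀ x ∈ Set.Ico (0:ℝ) 1, y x = 0 := by
    intro x hx
    have hfx : f x = 0 := by rw [hf]; rfl
    change AddCircle.liftIco 1 0 z x = 0 at hfx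
    rw [AddCircle.liftIco_zero_coe_apply hx] at hfx
    exact (mul_eq_zero.mp hfx).resolve_right (Complex.exp_ne_zero _)
  intro x hx
  rcases hx.2.eq_or_lt with rfl | hlt
  · rw [hbc, hIco 0 (by simp), mul_zero]
  · exact hIco x ⟨hx.1, hlt⟩

lemma IsEigenvalueH.hasBoundedSol {a b : ℂ} {t : ℝ} {lam : ℂ} (H : IsEigenvalueH a b t lam) :
    HasBoundedSol a b t lam := by
  obtain ⟨y, hy, hy0, hode, hbc, hbc'⟩ := H
  obtain ⟨hd, -, hy'⟩ := contDiff_succ_iff_deriv.mp (show ContDiff ℝ (1 + 1) y by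
    rwa [show (1 + 1 : WithTop ℕ∞) = 2 by norm_num])
  obtain ⟨hd', hcont''⟩ := contDiff_one_iff_deriv.mp hy'
  have hc : Continuous y := hd.continuous
  have hmul : ∀ n, Continuous fun x => y x * floquetMode (-t) (-n) x := fun n =>
    hc.mul (continuous_floquetMode _ _)
  have hmul'' : ∀ n, Continuous fun x =>
      (deriv (deriv y) x + (floquetFreq t n : ℂ) ^ 2 * y x) * floquetMode (-t) (-n) x := fun n =>
    (hcont''.add (hc.const_mul _)).mul (continuous_floquetMode _ _)
  refine ⟨fun n => ∫ x in (0:ℝ)..1, y x * floquetMode (-t) (-n) x, fun h0 => hy0 ?_,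
    ⟨∫ x in (0:ℝ)..1, ‖y x‖, fun n => ?_⟩, fun n => ?_⟩
  · exact eq_zero_on_Icc_of_integral_floquetMode_eq_zero hc hbc (congrFun h0)
  · refine intervalIntegral.norm_integral_le_of_norm_le zero_le_one
      (.of_forall fun x _ => ?_) (hc.norm.intervalIntegrable _ _)
    simp [norm_floquetMode]
  · have hparts : ∫ x in (0:ℝ)..1,
        (deriv (deriv y) x + (floquetFreq t n : ℂ) ^ 2 * y x) * floquetMode (-t) (-n) x = 0 := by
      rw [intervalIntegral.integral_eq_sub_of_hasDerivAt
        (f := fun x => (deriv y x + Complex.I * floquetFreq t n * y x) *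
          floquetMode (-t) (-n) x)]
      · simp only [floquetMode_one, floquetMode_zero, hbc, hbc', mul_one]
        have : Complex.exp (Complex.I * t) * Complex.exp (Complex.I * (-t : ℝ)) = 1 := by
          rw [← Complex.exp_add]
          simp
        linear_combination (deriv y 0 + Complex.I * floquetFreq t n * y 0) * this
      · intro x _
        refine (((hd' x).hasDerivAt.add ((hd x).hasDerivAt.const_mul _)).mul
          (hasDerivAt_floquetMode (-t) (-n) x)).congr_deriv ?_
        simp only [floquetFreq_neg, Pi.add_apply]
        push_cast
        linear_combination -(floquetFreq t n : ℂ) ^ 2 * y x * floquetMode (-t) (-n) x *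
          Complex.I_sq
      · exact (hmul'' n).intervalIntegrable _ _
    have hpoint : ∀ x ∈ Set.uIcc (0:ℝ) 1,
        a * (y x * floquetMode (-t) (-(n + 1)) x) + b * (y x * floquetMode (-t) (-(n - 1)) x) =
          (deriv (deriv y) x + (floquetFreq t n : ℂ) ^ 2 * y x) * floquetMode (-t) (-n) x +
            (lam - (floquetFreq t n : ℂ) ^ 2) * (y x * floquetMode (-t) (-n) x) := by
      intro x hx
      rw [Set.uIcc_of_le zero_le_one] at hx
      have hpot := mathieuPot_mul_floquetMode a b (-t) (-n) x
      rw [show -n - 1 = -(n + 1) by ring, show -n + 1 = -(n - 1) by ring] at hpot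
      linear_combination floquetMode (-t) (-n) x * hode x hx - y x * hpot
    have hint := intervalIntegral.integral_congr (μ := MeasureTheory.volume) hpoint
    rw [intervalIntegral.integral_add (((hmul _).const_mul a).intervalIntegrable _ _)
        (((hmul _).const_mul b).intervalIntegrable _ _),
      intervalIntegral.integral_add ((hmul'' n).intervalIntegrable _ _)
        (((hmul n).const_mul _).intervalIntegrable _ _), hparts, zero_add] at hint
    simpa only [intervalIntegral.integral_const_mul] using hint

lemma isEigenvalueH_iff_hasBoundedSol (a b : ℂ) (t : ℝ) (lam : ℂ) :
    IsEigenvalueH a b t lam ↔ HasBoundedSol a b t lam :=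
  ⟨IsEigenvalueH.hasBoundedSol, HasBoundedSol.isEigenvalueH⟩

theorem isospectral_H_of_ab_eq_cd (a b c d : ℂ) (h : a * b = c * d) :
    ∀ lam : ℂ,
      (∃ t ∈ Set.Ioc (-Real.pi) Real.pi, IsEigenvalueH a b t lam) ↔
        (∃ t ∈ Set.Ioc (-Real.pi) Real.pi, IsEigenvalueH c d t lam) := by
  intro lam
  simp only [isEigenvalueH_iff_hasBoundedSol, hasBoundedSol_congr h]
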